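/- Let (φ, ξ, η) be an almost contact metric structure on a finite-dimensional real inner product space (V, g), let c ∈ ℝ, let ρ ∈ ℝ, and set R1 := R^c, R2 := R2_ρ, R3 := R3_ρ, where R^c = S1 + S2 + S3. Then for every pair (α, E) with either α = 1 and E ∈ {1, 2, 3}, or E = 3 and α ∈ {1, 2, 3}, the following End(V)-valued 4-multilinear maps have vanishing alternatization: (x₁, x₂, x₃, x₄) ↦ Sα(x₁, x₂) ∘ RE(x₃, x₄) and (x₁, x₂, x₃, x₄) ↦ RE(x₁, x₂) ∘ Sα(x₃, x₄). -/

import Mathlib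

open scoped RealInnerProductSpace

/-- The alternatization (with the `1/p!` normalization) of a `p`-multilinear map. -/
noncomputable def Alt {V W : Type*} [AddCommGroup W] [Module ℝ W] {n : ℕ}
    (T : (Fin n → V) → W) : (Fin n → V) → W :=
  fun x => (n.factorial : ℝ)⁻¹ •
    ∑ σ : Equiv.Perm (Fin n), (Equiv.Perm.sign σ : ℤ) • T (fun i => x (σ i))

/-- The fundamental 2-form `Φ(u,v) = g(φ u, v)`. -/
noncomputable def Phi {V : Type*} [NormedAddCommGroup V] [InnerProductSpace ℝ V]
    (φ : V →ₗ[ℝ] V) (u v : V) : ℝ := ⟪φ u, v⟫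

/-- `S1(x,y)(z) = ((c+3)/4)(g(y,z)x − g(x,z)y)`. -/
noncomputable def S1 {V : Type*} [NormedAddCommGroup V] [InnerProductSpace ℝ V]
    (c : ℝ) (x y z : V) : V :=
  ((c + 3) / 4) • (⟪y, z⟫ • x - ⟪x, z⟫ • y)

/-- `S2(x,y)(z)`. -/
noncomputable def S2 {V : Type*} [NormedAddCommGroup V] [InnerProductSpace ℝ V]
    (φ : V →ₗ[ℝ] V) (ξ : V) (η : V →ₗ[ℝ] ℝ) (c : ℝ) (x y z : V) : V :=
  (-((c - 1) / 4)) • (Phi φ x z • φ y - Phi φ y z • φ x + (2 * Phi φ x y) • φ z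
    + (2 * η z * η x) • y - (2 * η y * η z) • x
    + (⟪x, z⟫ * η y) • ξ - (⟪y, z⟫ * η x) • ξ)

/-- `S3(x,y)(z)`. -/
noncomputable def S3 {V : Type*} [NormedAddCommGroup V] [InnerProductSpace ℝ V]
    (ξ : V) (η : V →ₗ[ℝ] ℝ) (c : ℝ) (x y z : V) : V :=
  ((c - 1) / 4) • ((3 * η z * η x) • y - (3 * η y * η z) • x
    + (2 * ⟪x, z⟫ * η y) • ξ - (2 * ⟪z, y⟫ * η x) • ξ)

/-- The tensor `R2_ρ`. -/
noncomputable def R2 {V : Type*} [NormedAddCommGroup V] [InnerProductSpace ℝ V]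
    (φ : V →ₗ[ℝ] V) (ξ : V) (η : V →ₗ[ℝ] ℝ) (ρ : ℝ) (x y z : V) : V :=
  (-(ρ ^ 2)) • (Phi φ x z • φ y - Phi φ y z • φ x + (2 * Phi φ x y) • φ z
    + (2 * η x * η z) • y - (2 * η y * η z) • x
    + (⟪x, z⟫ * η y) • ξ - (⟪y, z⟫ * η x) • ξ)

/-- The tensor `R3_ρ`. -/
noncomputable def R3 {V : Type*} [NormedAddCommGroup V] [InnerProductSpace ℝ V]
    (η : V →ₗ[ℝ] ℝ) (ρ : ℝ) (x y z : V) : V :=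
  (ρ ^ 4) • ((η y * η z) • x - (η x * η z) • y)

/-- The family `Sα` for `α = 1, 2, 3` (and `0` otherwise). -/
noncomputable def SS {V : Type*} [NormedAddCommGroup V] [InnerProductSpace ℝ V]
    (φ : V →ₗ[ℝ] V) (ξ : V) (η : V →ₗ[ℝ] ℝ) (c : ℝ) : ℕ → V → V → V → V
  | 1 => S1 c
  | 2 => S2 φ ξ η c
  | 3 => S3 ξ η c
  | _ => fun _ _ _ => 0

/-- The family `RE` for `E = 1, 2, 3` (and `0` otherwise), where
`R1 = R^c = S1 + S2 + S3`, `R2 = R2_ρ` and `R3 = R3_ρ`. -/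
noncomputable def RR {V : Type*} [NormedAddCommGroup V] [InnerProductSpace ℝ V]
    (φ : V →ₗ[ℝ] V) (ξ : V) (η : V →ₗ[ℝ] ℝ) (c ρ : ℝ) : ℕ → V → V → V → V
  | 1 => fun x y z => S1 c x y z + S2 φ ξ η c x y z + S3 ξ η c x y z
  | 2 => R2 φ ξ η ρ
  | 3 => R3 η ρ
  | _ => fun _ _ _ => 0

theorem aux_key {V W : Type*} [AddCommGroup W] [Module ℝ W] (P : V → V → V → V → W)
    (hP : ∀ a b c d, P a b c d + P a c d b + P a d b c = 0) (τ : Equiv.Perm (Fin 4))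
    (x : Fin 4 → V) :
    ∑ σ : Equiv.Perm (Fin 4), (Equiv.Perm.sign σ : ℤ) •
      P (x (σ (τ 0))) (x (σ (τ 1))) (x (σ (τ 2))) (x (σ (τ 3))) = 0 := by
  have re : ∀ (κ : Equiv.Perm (Fin 4)) (F : (Fin 4 → V) → W),
      ∑ σ : Equiv.Perm (Fin 4), (Equiv.Perm.sign σ : ℤ) • F (fun i => x (σ (κ i))) =
      (Equiv.Perm.sign κ : ℤ) • ∑ σ : Equiv.Perm (Fin 4), (Equiv.Perm.sign σ : ℤ) •
        F (fun i => x (σ i)) := by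
    intro κ F
    rw [← Equiv.sum_comp (Equiv.mulRight κ) (fun σ : Equiv.Perm (Fin 4) =>
      (Equiv.Perm.sign σ : ℤ) • F (fun i => x (σ i))), Finset.smul_sum]
    refine Finset.sum_congr rfl fun σ _ => ?_
    rcases Int.units_eq_one_or (Equiv.Perm.sign κ) with h | h <;>
      simp [h, Equiv.Perm.sign_mul]
  have h0 := re τ (fun y => P (y 0) (y 1) (y 2) (y 3))
  have s1 : Equiv.Perm.sign (Equiv.swap (1 : Fin 4) 2 * Equiv.swap 2 3) = 1 := by decide
  have s2 : Equiv.Perm.sign (Equiv.swap (2 : Fin 4) 3 * Equiv.swap 1 2) = 1 := by decide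
  have h1 := re (Equiv.swap 1 2 * Equiv.swap 2 3) (fun y => P (y 0) (y 1) (y 2) (y 3))
  have h2 := re (Equiv.swap 2 3 * Equiv.swap 1 2) (fun y => P (y 0) (y 1) (y 2) (y 3))
  rw [s1] at h1
  rw [s2] at h2
  have e10 : (Equiv.swap (1 : Fin 4) 2 * Equiv.swap 2 3 : Equiv.Perm (Fin 4)) 0 = 0 := by decide
  have e11 : (Equiv.swap (1 : Fin 4) 2 * Equiv.swap 2 3 : Equiv.Perm (Fin 4)) 1 = 2 := by decide
  have e12 : (Equiv.swap (1 : Fin 4) 2 * Equiv.swap 2 3 : Equiv.Perm (Fin 4)) 2 = 3 := by decide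
  have e13 : (Equiv.swap (1 : Fin 4) 2 * Equiv.swap 2 3 : Equiv.Perm (Fin 4)) 3 = 1 := by decide
  have e20 : (Equiv.swap (2 : Fin 4) 3 * Equiv.swap 1 2 : Equiv.Perm (Fin 4)) 0 = 0 := by decide
  have e21 : (Equiv.swap (2 : Fin 4) 3 * Equiv.swap 1 2 : Equiv.Perm (Fin 4)) 1 = 3 := by decide
  have e22 : (Equiv.swap (2 : Fin 4) 3 * Equiv.swap 1 2 : Equiv.Perm (Fin 4)) 2 = 1 := by decide
  have e23 : (Equiv.swap (2 : Fin 4) 3 * Equiv.swap 1 2 : Equiv.Perm (Fin 4)) 3 = 2 := by decide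
  simp only [e10, e11, e12, e13, Units.val_one, one_smul] at h1
  simp only [e20, e21, e22, e23, Units.val_one, one_smul] at h2
  rw [h0]
  set S := ∑ σ : Equiv.Perm (Fin 4), (Equiv.Perm.sign σ : ℤ) •
    P (x (σ 0)) (x (σ 1)) (x (σ 2)) (x (σ 3)) with hS
  have h3 : S + S + S = 0 := by
    conv_lhs => 
      enter [2]
      rw [← h2]
    conv_lhs => 
      enter [1, 2]
      rw [← h1]
    rw [hS, ← Finset.sum_add_distrib, ← Finset.sum_add_distrib]
    refine Finset.sum_eq_zero fun σ _ => ?_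
    rw [← smul_add, ← smul_add, hP, smul_zero]
  have h4 : S = 0 := by
    have : (3 : ℝ) • S = 0 := by rw [← h3]; module
    simpa using this
  rw [h4, smul_zero]

theorem aux_alt {V : Type*} [NormedAddCommGroup V] [InnerProductSpace ℝ V]
    (T : V → V → V → V → V → V) (P : V → V → V → V → V → V) (τ κ : Equiv.Perm (Fin 4))
    (hP : ∀ v a b c d, P v a b c d + P v a c d b + P v a d b c = 0)
    (hT : ∀ v (x : Fin 4 → V), T (x 0) (x 1) (x 2) (x 3) v =
      P v (x (τ 0)) (x (τ 1)) (x (τ 2)) (x (τ 3)) -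
      P v (x (κ 0)) (x (κ 1)) (x (κ 2)) (x (κ 3))) :
    Alt (fun x : Fin 4 → V => fun v => T (x 0) (x 1) (x 2) (x 3) v) = 0 := by
  funext x v
  simp only [Alt, Pi.smul_apply, Finset.sum_apply, Pi.zero_apply]
  have : ∀ σ : Equiv.Perm (Fin 4),
      T (x (σ 0)) (x (σ 1)) (x (σ 2)) (x (σ 3)) v = _ := fun σ => hT v (fun i => x (σ i))
  simp only [this, smul_sub, Finset.sum_sub_distrib, aux_key (P v) (hP v), sub_zero, smul_zero]

/-- outer map `(x, y) ↦ l y • x - l x • y` -/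
theorem aux_left {V : Type*} [NormedAddCommGroup V] [InnerProductSpace ℝ V]
    (S R : V → V → V → V) (f : V → V → ℝ)
    (hS : ∀ x y z, S x y z = f y z • x - f x z • y)
    (hR : ∀ v b c d, f b (R c d v) + f c (R d b v) + f d (R b c v) = 0) :
    Alt (fun x : Fin 4 → V => fun v => S (x 0) (x 1) (R (x 2) (x 3) v)) = 0 := by
  refine aux_alt (fun a b c d v => S a b (R c d v)) (fun v a b c d => f b (R c d v) • a)
    1 (Equiv.swap 0 1) ?_ ?_
  · intro v a b c d
    rw [← add_smul, ← add_smul, hR, zero_smul]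
  · intro v x
    have e2 : Equiv.swap (0 : Fin 4) 1 2 = 2 := by decide
    have e3 : Equiv.swap (0 : Fin 4) 1 3 = 3 := by decide
    simp [hS, e2, e3]

/-- inner map `(x, y) ↦ l y • x - l x • y` -/
theorem aux_right {V : Type*} [NormedAddCommGroup V] [InnerProductSpace ℝ V]
    (S R : V → V → V → V) (f : V → V → ℝ)
    (hS : ∀ x y z, S x y z = f y z • x - f x z • y)
    (hl : ∀ x y (r s : ℝ) z w, R x y (r • z - s • w) = r • R x y z - s • R x y w)
    (hR : ∀ b c d, R c d b + R d b c + R b c d = 0) :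
    Alt (fun x : Fin 4 → V => fun v => R (x 0) (x 1) (S (x 2) (x 3) v)) = 0 := by
  have d0 : (Equiv.swap (0 : Fin 4) 3 * Equiv.swap 1 2 * Equiv.swap 2 3 : Equiv.Perm (Fin 4)) 0 = 3 := by decide
  have d1 : (Equiv.swap (0 : Fin 4) 3 * Equiv.swap 1 2 * Equiv.swap 2 3 : Equiv.Perm (Fin 4)) 1 = 2 := by decide
  have d2 : (Equiv.swap (0 : Fin 4) 3 * Equiv.swap 1 2 * Equiv.swap 2 3 : Equiv.Perm (Fin 4)) 2 = 0 := by decide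
  have d3 : (Equiv.swap (0 : Fin 4) 3 * Equiv.swap 1 2 * Equiv.swap 2 3 : Equiv.Perm (Fin 4)) 3 = 1 := by decide
  have k0 : (Equiv.swap (0 : Fin 4) 2 * Equiv.swap 1 3 : Equiv.Perm (Fin 4)) 0 = 2 := by decide
  have k1 : (Equiv.swap (0 : Fin 4) 2 * Equiv.swap 1 3 : Equiv.Perm (Fin 4)) 1 = 3 := by decide
  have k2 : (Equiv.swap (0 : Fin 4) 2 * Equiv.swap 1 3 : Equiv.Perm (Fin 4)) 2 = 0 := by decide
  have k3 : (Equiv.swap (0 : Fin 4) 2 * Equiv.swap 1 3 : Equiv.Perm (Fin 4)) 3 = 1 := by decide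
  refine aux_alt (fun a b c d v => R a b (S c d v)) (fun v a b c d => f a v • R c d b)
    (Equiv.swap (0 : Fin 4) 3 * Equiv.swap 1 2 * Equiv.swap 2 3)
    (Equiv.swap (0 : Fin 4) 2 * Equiv.swap 1 3) ?_ ?_
  · intro v a b c d
    rw [← smul_add, ← smul_add, hR, smul_zero]
  · intro v x
    simp only [hS, hl, d0, d1, d2, d3, k0, k1, k2, k3]

theorem S_alpha_RE_compositions_alternatization_zero
    {V : Type*} [NormedAddCommGroup V] [InnerProductSpace ℝ V] [FiniteDimensional ℝ V]
    (φ : V →ₗ[ℝ] V) (ξ : V) (η : V →ₗ[ℝ] ℝ)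
    (hφφ : ∀ v, φ (φ v) = -v + η v • ξ)
    (hηξ : η ξ = 1)
    (hφξ : φ ξ = 0)
    (hηφ : ∀ v, η (φ v) = 0)
    (hmetric : ∀ u v, ⟪φ u, φ v⟫ = ⟪u, v⟫ - η u * η v)
    (c ρ : ℝ) :
    ∀ α E : ℕ,
      ((α = 1 ∧ (E = 1 ∨ E = 2 ∨ E = 3)) ∨ (E = 3 ∧ (α = 1 ∨ α = 2 ∨ α = 3))) →
      Alt (fun x : Fin 4 → V => fun v =>
          SS φ ξ η c α (x 0) (x 1) (RR φ ξ η c ρ E (x 2) (x 3) v)) = 0 ∧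
      Alt (fun x : Fin 4 → V => fun v =>
          RR φ ξ η c ρ E (x 0) (x 1) (SS φ ξ η c α (x 2) (x 3) v)) = 0 := by
  have hξ : ∀ v, ⟪ξ, v⟫ = η v := by
    intro v
    have := hmetric ξ v
    rw [hφξ, inner_zero_left, hηξ] at this
    linarith
  have hξ' : ∀ v, ⟪v, ξ⟫ = η v := fun v => by rw [real_inner_comm, hξ]
  have hsk : ∀ u v, ⟪u, φ v⟫ = -⟪φ u, v⟫ := by
    intro u v
    have := hmetric (φ u) v
    rw [hφφ, hηφ, inner_add_left, inner_neg_left, inner_smul_left, hξ, hηφ] at this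
    simp at this
    linarith
  have hcm : ∀ u v, ⟪φ u, v⟫ = -⟪φ v, u⟫ := fun u v => by
    rw [← hsk, real_inner_comm]
  -- linearity
  have l1 : ∀ (x y : V) (r s : ℝ) (z w : V), S1 c x y (r • z - s • w) = r • S1 c x y z - s • S1 c x y w := by
    intro x y r s z w
    simp only [S1, inner_sub_right, inner_smul_right]
    module
  have l2 : ∀ x y (r s : ℝ) z w, S2 φ ξ η c x y (r • z - s • w) =
      r • S2 φ ξ η c x y z - s • S2 φ ξ η c x y w := by
    intro x y r s z w
    simp only [S2, Phi, inner_sub_right, inner_smul_right, map_sub, map_smul, smul_eq_mul]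
    module
  have l3 : ∀ x y (r s : ℝ) z w, S3 ξ η c x y (r • z - s • w) =
      r • S3 ξ η c x y z - s • S3 ξ η c x y w := by
    intro x y r s z w
    simp only [S3, inner_sub_right, inner_sub_left, inner_smul_left, inner_smul_right, map_sub,
      map_smul, smul_eq_mul, conj_trivial]
    module
  have lR2 : ∀ x y (r s : ℝ) z w, R2 φ ξ η ρ x y (r • z - s • w) =
      r • R2 φ ξ η ρ x y z - s • R2 φ ξ η ρ x y w := by
    intro x y r s z w
    simp only [R2, Phi, inner_sub_right, inner_smul_right, map_sub, map_smul, smul_eq_mul]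
    module
  have lR3 : ∀ x y (r s : ℝ) z w, R3 η ρ x y (r • z - s • w) =
      r • R3 η ρ x y z - s • R3 η ρ x y w := by
    intro x y r s z w
    simp only [R3, map_sub, map_smul, smul_eq_mul]
    module
  -- Bianchi
  have b1 : ∀ b d e : V, S1 c d e b + S1 c e b d + S1 c b d e = 0 := by
    intro b d e
    simp only [S1]
    rw [real_inner_comm b d, real_inner_comm e b, real_inner_comm d e]
    module
  have b2 : ∀ b d e, S2 φ ξ η c d e b + S2 φ ξ η c e b d + S2 φ ξ η c b d e = 0 := by
    intro b d e
    simp only [S2, Phi]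
    rw [real_inner_comm b d, real_inner_comm e b, real_inner_comm d e, hcm b d, hcm e b, hcm d e]
    module
  have b3 : ∀ b d e, S3 ξ η c d e b + S3 ξ η c e b d + S3 ξ η c b d e = 0 := by
    intro b d e
    simp only [S3]
    rw [real_inner_comm b d, real_inner_comm e b, real_inner_comm d e]
    module
  have bR2 : ∀ b d e, R2 φ ξ η ρ d e b + R2 φ ξ η ρ e b d + R2 φ ξ η ρ b d e = 0 := by
    intro b d e
    simp only [R2, Phi]
    rw [real_inner_comm b d, real_inner_comm e b, real_inner_comm d e, hcm b d, hcm e b, hcm d e]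
    module
  have bR3 : ∀ b d e, R3 η ρ d e b + R3 η ρ e b d + R3 η ρ b d e = 0 := by
    intro b d e
    simp only [R3]
    module
  -- lowered identities
  have g1 : ∀ v b d e : V, ⟪b, S1 c d e v⟫ + ⟪d, S1 c e b v⟫ + ⟪e, S1 c b d v⟫ = 0 := by
    intro v b d e
    simp only [S1, inner_sub_right, inner_smul_right]
    rw [real_inner_comm b d, real_inner_comm e b, real_inner_comm d e]
    ring
  have g2 : ∀ v b d e, ⟪b, S2 φ ξ η c d e v⟫ + ⟪d, S2 φ ξ η c e b v⟫
      + ⟪e, S2 φ ξ η c b d v⟫ = 0 := by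
    intro v b d e
    simp only [S2, Phi, inner_sub_right, inner_add_right, inner_smul_right, hξ', hsk]
    rw [real_inner_comm b d, real_inner_comm e b, real_inner_comm d e, hcm b d, hcm e b, hcm d e]
    ring
  have g3 : ∀ v b d e, ⟪b, S3 ξ η c d e v⟫ + ⟪d, S3 ξ η c e b v⟫ + ⟪e, S3 ξ η c b d v⟫ = 0 := by
    intro v b d e
    simp only [S3, inner_sub_right, inner_add_right, inner_smul_right, hξ']
    rw [real_inner_comm b d, real_inner_comm e b, real_inner_comm d e, real_inner_comm b v,
      real_inner_comm d v, real_inner_comm e v]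
    ring
  have gR2 : ∀ v b d e, ⟪b, R2 φ ξ η ρ d e v⟫ + ⟪d, R2 φ ξ η ρ e b v⟫
      + ⟪e, R2 φ ξ η ρ b d v⟫ = 0 := by
    intro v b d e
    simp only [R2, Phi, inner_sub_right, inner_add_right, inner_smul_right, hξ', hsk]
    rw [real_inner_comm b d, real_inner_comm e b, real_inner_comm d e, hcm b d, hcm e b, hcm d e]
    ring
  have gR3 : ∀ v b d e, ⟪b, R3 η ρ d e v⟫ + ⟪d, R3 η ρ e b v⟫ + ⟪e, R3 η ρ b d v⟫ = 0 := by
    intro v b d e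
    simp only [R3, inner_sub_right, inner_smul_right]
    rw [real_inner_comm b d, real_inner_comm e b, real_inner_comm d e]
    ring
  -- eta identities
  have n1 : ∀ v b d e, η b * η (S1 c d e v) + η d * η (S1 c e b v) + η e * η (S1 c b d v) = 0 := by
    intro v b d e
    simp only [S1, map_sub, map_smul, smul_eq_mul]
    ring
  have n2 : ∀ v b d e, η b * η (S2 φ ξ η c d e v) + η d * η (S2 φ ξ η c e b v)
      + η e * η (S2 φ ξ η c b d v) = 0 := by
    intro v b d e
    simp only [S2, map_sub, map_add, map_smul, smul_eq_mul, hηφ, hηξ]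
    ring
  have n3 : ∀ v b d e, η b * η (S3 ξ η c d e v) + η d * η (S3 ξ η c e b v)
      + η e * η (S3 ξ η c b d v) = 0 := by
    intro v b d e
    simp only [S3, map_sub, map_add, map_smul, smul_eq_mul, hηφ, hηξ]
    rw [real_inner_comm b v, real_inner_comm d v, real_inner_comm e v]
    ring
  have fS : ∀ x y z : V, S1 c x y z = ((c + 3) / 4 * ⟪y, z⟫) • x - ((c + 3) / 4 * ⟪x, z⟫) • y := by
    intro x y z
    simp only [S1]
    module
  have fR : ∀ x y z : V, R3 η ρ x y z = (ρ ^ 4 * (η y * η z)) • x - (ρ ^ 4 * (η x * η z)) • y := by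
    intro x y z
    simp only [R3]
    module
  have A : ∀ R : V → V → V → V,
      (∀ v b d e, ⟪b, R d e v⟫ + ⟪d, R e b v⟫ + ⟪e, R b d v⟫ = 0) →
      (∀ x y (r s : ℝ) z w, R x y (r • z - s • w) = r • R x y z - s • R x y w) →
      (∀ b d e, R d e b + R e b d + R b d e = 0) →
      Alt (fun x : Fin 4 → V => fun v => S1 c (x 0) (x 1) (R (x 2) (x 3) v)) = 0 ∧
      Alt (fun x : Fin 4 → V => fun v => R (x 0) (x 1) (S1 c (x 2) (x 3) v)) = 0 := by
    intro R h1 h2 h3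
    refine ⟨aux_left (S1 c) R (fun y z => (c + 3) / 4 * ⟪y, z⟫) fS ?_,
      aux_right (S1 c) R (fun y z => (c + 3) / 4 * ⟪y, z⟫) fS h2 h3⟩
    intro v b d e
    linear_combination (c + 3) / 4 * h1 v b d e
  have B : ∀ S : V → V → V → V,
      (∀ v b d e, η b * η (S d e v) + η d * η (S e b v) + η e * η (S b d v) = 0) →
      (∀ x y (r s : ℝ) z w, S x y (r • z - s • w) = r • S x y z - s • S x y w) →
      (∀ b d e, S d e b + S e b d + S b d e = 0) →
      Alt (fun x : Fin 4 → V => fun v => S (x 0) (x 1) (R3 η ρ (x 2) (x 3) v)) = 0 ∧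
      Alt (fun x : Fin 4 → V => fun v => R3 η ρ (x 0) (x 1) (S (x 2) (x 3) v)) = 0 := by
    intro S h1 h2 h3
    refine ⟨aux_right (R3 η ρ) S (fun y z => ρ ^ 4 * (η y * η z)) fR h2 h3,
      aux_left (R3 η ρ) S (fun y z => ρ ^ 4 * (η y * η z)) fR ?_⟩
    intro v b d e
    linear_combination ρ ^ 4 * h1 v b d e
  rintro α E (⟨rfl, rfl | rfl | rfl⟩ | ⟨rfl, rfl | rfl | rfl⟩)
  · refine A (fun x y z => S1 c x y z + S2 φ ξ η c x y z + S3 ξ η c x y z) ?_ ?_ ?_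
    · intro v b d e
      simp only [inner_add_right]
      linear_combination g1 v b d e + g2 v b d e + g3 v b d e
    · intro x y r s z w
      simp only [l1, l2, l3]
      module
    · intro b d e
      linear_combination (norm := module) b1 b d e + b2 b d e + b3 b d e
  · exact A (R2 φ ξ η ρ) gR2 lR2 bR2
  · exact A (R3 η ρ) gR3 lR3 bR3
  · exact B (S1 c) n1 l1 b1
  · exact B (S2 φ ξ η c) n2 l2 b2
  · exact B (S3 ξ η c) n3 l3 b3
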